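/- Let k be a perfect field of characteristic 2 and B = k[[x,y]]. Let R, S, T ∈ B be elements with no common non-unit divisor. Then the elements S² + T²·x and R² + T²·y of B have no common non-unit divisor. -/

import Mathlib

namespace MvPowerSeries

instance isDomain {σ R : Type*} [Ring R] [IsDomain R] : IsDomain (MvPowerSeries σ R) :=
  NoZeroDivisors.to_isDomain _

instance isPrincipalIdealRing_of_unique {σ k : Type*} [Unique σ] [Field k] :
    IsPrincipalIdealRing (MvPowerSeries σ k) :=
  let e : PowerSeries k ≃ₐ[k] MvPowerSeries σ k := renameEquiv k (Equiv.ofUnique Unit σ)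
  IsPrincipalIdealRing.of_surjective e e.surjective

instance uniqueFactorizationMonoid_fin_two {k : Type*} [Field k] :
    UniqueFactorizationMonoid (MvPowerSeries (Fin 2) k) :=
  (finSuccEquiv k 1).symm.toMulEquiv.uniqueFactorizationMonoid inferInstance

theorem prime_X_zero {k : Type*} [CommRing k] [IsDomain k] {n : ℕ} :
    Prime (X 0 : MvPowerSeries (Fin (n + 1)) k) := by
  rw [← MulEquiv.prime_iff (finSuccEquiv k n)]
  simpa using PowerSeries.X_prime

end MvPowerSeries

/-- In characteristic `2`, let `D₀`, `D₁` be derivations dual to the elements `x`, `y`. A prime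
dividing both `s² + t²x` and `r² + t²y` divides `r`, `s` and `t`. -/
theorem Prime.dvd_of_dvd_sq_add_sq_mul {k A : Type*} [CommRing k] [CommRing A] [Algebra k A]
    [CharP A 2] (D₀ D₁ : Derivation k A A) {x y : A} (hx₀ : D₀ x = 1) (hx₁ : D₁ x = 0)
    (hy₁ : D₁ y = 1) {p r s t : A} (hp : Prime p)
    (hs : p ∣ s ^ 2 + t ^ 2 * x) (hr : p ∣ r ^ 2 + t ^ 2 * y) : p ∣ r ∧ p ∣ s ∧ p ∣ t := by
  have two : (2 : A) = 0 := CharTwo.two_eq_zero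
  have hD (D : Derivation k A A) (a b z : A) : D (a ^ 2 + b ^ 2 * z) = b ^ 2 * D z := by
    simp only [map_add, Derivation.leibniz, Derivation.leibniz_pow, smul_eq_mul, nsmul_eq_mul]
    push_cast
    linear_combination (a * D a + z * b * D b) * two
  have ht : p ∣ t := by
    obtain ⟨u, hu⟩ := hs
    obtain ⟨v, hv⟩ := hr
    have h₀ := congrArg D₀ hu
    have h₁ := congrArg D₁ hu
    have h₂ := congrArg D₁ hv
    simp only [hD, hx₀, hx₁, hy₁, Derivation.leibniz, smul_eq_mul, mul_one, mul_zero]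
      at h₀ h₁ h₂
    refine hp.dvd_of_dvd_pow (n := 4)
      ⟨D₀ u * t ^ 2 + u * D₀ p * D₁ v - D₁ u * v * D₀ p, ?_⟩
    linear_combination t ^ 2 * h₀ + u * D₀ p * h₂ - v * D₀ p * h₁
  have dvd_of_dvd {a z : A} (h : p ∣ a ^ 2 + t ^ 2 * z) : p ∣ a :=
    hp.dvd_of_dvd_pow <|
      (dvd_add_left ((dvd_pow ht two_ne_zero).mul_right z)).1 h
  exact ⟨dvd_of_dvd hr, dvd_of_dvd hs, ht⟩


/-- Let `k` be a perfect field of characteristic `2` and `B = k[[x,y]]`.  If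
`R, S, T ∈ B` have no common non-unit divisor, then `S² + T²·x` and `R² + T²·y` have no
common non-unit divisor. -/
theorem no_common_divisor {k : Type*} [Field k] [CharP k 2] [PerfectRing k 2]
    (R S T : MvPowerSeries (Fin 2) k)
    (hcoprime : ∀ d : MvPowerSeries (Fin 2) k, d ∣ R → d ∣ S → d ∣ T → IsUnit d) :
    ∀ d : MvPowerSeries (Fin 2) k,
      d ∣ S ^ 2 + T ^ 2 * MvPowerSeries.X 0 →
      d ∣ R ^ 2 + T ^ 2 * MvPowerSeries.X 1 → IsUnit d := by
  intro d hdS hdR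
  by_contra hd
  have : CharP (MvPowerSeries (Fin 2) k) 2 :=
    charP_of_injective_algebraMap (algebraMap k (MvPowerSeries (Fin 2) k)).injective 2
  obtain ⟨p, hp, hpd⟩ : ∃ p, Prime p ∧ p ∣ d := by
    by_cases hd₀ : d = 0
    · exact ⟨MvPowerSeries.X 0, MvPowerSeries.prime_X_zero, hd₀ ▸ dvd_zero _⟩
    · obtain ⟨p, hp, hpd⟩ := WfDvdMonoid.exists_irreducible_factor hd hd₀
      exact ⟨p, hp.prime, hpd⟩
  obtain ⟨hR, hS, hT⟩ := hp.dvd_of_dvd_sq_add_sq_mul (MvPowerSeries.pderiv k 0)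
    (MvPowerSeries.pderiv k 1) MvPowerSeries.pderiv_X_self
    (MvPowerSeries.pderiv_X_of_ne zero_ne_one) MvPowerSeries.pderiv_X_self
    (hpd.trans hdS) (hpd.trans hdR)
  exact hp.not_isUnit (hcoprime p hR hS hT)
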